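/- Let (A, Tⁿ) be a spanning toric hyperplane arrangement in general position consisting of m ≥ n hyperplanes H₁,…,H_m with normal vectors a₁,…,a_m ∈ ℤⁿ. Then the number of n-flats (regions) of A is f_n(A) = Σ_{S ⊆ {1,…,m}, |S| = n} |det(a_{i₁} | a_{i₂} | ⋯ | a_{iₙ})|, the sum over all n-element subsets S = {i₁,…,iₙ} of the absolute values of the determinants of the matrices formed by the corresponding normal vectors. -/

import Mathlib

open Set

/-- The `n`-torus `ℝⁿ/ℤⁿ`, modelled as a product of circles `ℝ/ℤ`. -/
abbrev Torus (n : ℕ) := Fin n → AddCircle (1 : ℝ)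

/-- The group homomorphism `Tⁿ → ℝ/ℤ` induced by `x ↦ a₁x₁ + ⋯ + aₙxₙ`. -/
noncomputable def theta {n : ℕ} (a : Fin n → ℤ) (x : Torus n) : AddCircle (1 : ℝ) :=
  ∑ i, a i • x i

/-- The affine toric hyperplane with normal vector `a` and intercept `c`. -/
def Hyp {n : ℕ} (a : Fin n → ℤ) (c : AddCircle (1 : ℝ)) : Set (Torus n) :=
  {x | theta a x = c}

/-- The set of connected components of a subset `A` of a topological space. -/
def comps {X : Type*} [TopologicalSpace X] (A : Set X) : Set (Set X) :=
  {C | ∃ x ∈ A, C = connectedComponentIn A x}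

/-- The set `Σ_k` of `k`-flats of an arrangement of hypersurfaces `K i` inside an
ambient space `W` of dimension `d`: `Σ_0` is the set of connected components of the
union over `d`-element index sets `S` of `⋂_{i ∈ S} K i`; for `0 < k < d`, `Σ_k` is the
union over `(d-k)`-element index sets `S` of the sets of connected components of
`⋂_{i ∈ S} K i` minus all lower-dimensional flats; and `Σ_d` is the set of connected
components of the complement `W \ ⋃ᵢ K i`. -/
noncomputable def SigIn {X : Type*} [TopologicalSpace X] {ι : Type*} [Fintype ι]
    (W : Set X) (d : ℕ) (K : ι → Set X) : ℕ → Set (Set X) := fun k =>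
  Nat.strongRecOn k (fun k ih =>
    if k = 0 then comps (⋃ S ∈ {S : Finset ι | S.card = d}, ⋂ i ∈ S, K i)
    else if k = d then comps (W \ ⋃ i, K i)
    else ⋃ S ∈ {S : Finset ι | S.card = d - k},
      comps ((⋂ i ∈ S, K i) \ ⋃ j : Fin k, ⋃ σ ∈ ih j j.isLt, σ))

/-- An arrangement (given by normal vectors `a`) is spanning if some `n` of the normal
vectors are linearly independent over `ℚ`. -/
def Spanning {ι : Type*} [Fintype ι] {n : ℕ} (a : ι → Fin n → ℤ) : Prop :=
  ∃ s : Finset ι, s.card = n ∧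
    LinearIndependent ℚ (fun i : s => fun j => (a i.1 j : ℚ))

/-- An arrangement is in general position if for every subset `S` of hyperplanes with
nonempty intersection, the corresponding normal vectors are linearly independent over `ℚ`. -/
def GenPos {ι : Type*} [Fintype ι] {n : ℕ} (a : ι → Fin n → ℤ)
    (b : ι → AddCircle (1 : ℝ)) : Prop :=
  ∀ S : Finset ι, (⋂ i ∈ S, Hyp (a i) (b i)).Nonempty →
    LinearIndependent ℚ (fun i : S => fun j => (a i.1 j : ℚ))

section Cells

open Filter Topology Module

variable {E ι : Type*} [NormedAddCommGroup E] [NormedSpace ℝ E]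

/-- The open cell of a periodic affine arrangement in which each `φ i - β i` has integer
part `κ i` and nonzero fractional part. -/
def openCell (φ : ι → Dual ℝ E) (β : ι → ℝ) (κ : ι → ℤ) : Set E :=
  {x | ∀ i, (κ i : ℝ) < φ i x - β i ∧ φ i x - β i < κ i + 1}

/-- The closed counterpart of `openCell`. -/
def closedCell (φ : ι → Dual ℝ E) (β : ι → ℝ) (κ : ι → ℤ) : Set E :=
  {x | ∀ i, (κ i : ℝ) ≤ φ i x - β i ∧ φ i x - β i ≤ κ i + 1}

open Classical in
/-- The indices of the hyperplane families passing through `x`. -/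
noncomputable def incident [Fintype ι] (φ : ι → Dual ℝ E) (β : ι → ℝ) (x : E) : Finset ι :=
  {i | ∃ k : ℤ, φ i x - β i = k}


lemma openCell_subset_closedCell (φ : ι → Dual ℝ E) (β : ι → ℝ) (κ : ι → ℤ) :
    openCell φ β κ ⊆ closedCell φ β κ :=
  fun _ hx i => ⟨(hx i).1.le, (hx i).2.le⟩

lemma convex_openCell (φ : ι → Dual ℝ E) (β : ι → ℝ) (κ : ι → ℤ) :
    Convex ℝ (openCell φ β κ) := by
  have : openCell φ β κ = ⋂ i, φ i ⁻¹' Ioo (κ i + β i) (κ i + 1 + β i) := by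
    ext x
    simp only [openCell, mem_ofPred_eq, mem_iInter, mem_preimage, mem_Ioo, lt_sub_iff_add_lt,
      sub_lt_iff_lt_add]
  rw [this]
  exact convex_iInter fun i => (convex_Ioo _ _).linear_preimage (φ i)

lemma isOpen_openCell [FiniteDimensional ℝ E] [Finite ι] (φ : ι → Dual ℝ E) (β : ι → ℝ)
    (κ : ι → ℤ) : IsOpen (openCell φ β κ) := by
  have hc := fun i => (φ i).continuous_of_finiteDimensional
  simp only [openCell, ofPred_forall]
  exact isOpen_iInter_of_finite fun i =>
    (isOpen_lt continuous_const ((hc i).sub continuous_const)).inter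
      (isOpen_lt ((hc i).sub continuous_const) continuous_const)

lemma isCompact_closedCell [FiniteDimensional ℝ E] [Finite ι] {φ : ι → Dual ℝ E}
    (hφ : ∀ x, (∀ i, φ i x = 0) → x = 0) (β : ι → ℝ) (κ : ι → ℤ) :
    IsCompact (closedCell φ β κ) := by
  have := Fintype.ofFinite ι
  have hemb : IsClosedEmbedding (LinearMap.pi φ) := by
    refine LinearMap.isClosedEmbedding_of_injective (LinearMap.ker_eq_bot'.2 fun x hx => ?_)
    exact hφ x fun i => congrFun hx i
  convert hemb.isCompact_preimage
    (isCompact_Icc (a := fun i => κ i + β i) (b := fun i => κ i + 1 + β i)) using 1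
  ext x
  simp [closedCell, Pi.le_def, le_sub_iff_add_le, forall_and]

lemma mem_incident [Fintype ι] {φ : ι → Dual ℝ E} {β : ι → ℝ} {x : E} {i : ι} :
    i ∈ incident φ β x ↔ ∃ k : ℤ, φ i x - β i = k := by
  simp [incident]

lemma mem_incident_iff [Fintype ι] {φ : ι → Dual ℝ E} {β : ι → ℝ} {κ : ι → ℤ} {x : E}
    (hx : x ∈ closedCell φ β κ) {i : ι} :
    i ∈ incident φ β x ↔ φ i x - β i = κ i ∨ φ i x - β i = κ i + 1 := by
  rw [mem_incident]
  constructor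
  · rintro ⟨k, hk⟩
    have := hx i
    rw [hk] at this ⊢
    norm_cast at this ⊢
    lia
  · rintro (h | h)
    · exact ⟨_, h⟩
    · exact ⟨κ i + 1, by rw [h]; push_cast; rfl⟩

lemma cell_eq_of_mem_openCell {φ : ι → Dual ℝ E} {β : ι → ℝ} {κ κ' : ι → ℤ} {x : E}
    (hx : x ∈ openCell φ β κ) (hx' : x ∈ openCell φ β κ') : κ = κ' := by
  funext i
  have h := Int.floor_eq_iff.2 ⟨(hx i).1.le, (hx i).2⟩
  rwa [Int.floor_eq_iff.2 ⟨(hx' i).1.le, (hx' i).2⟩, eq_comm] at h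

lemma add_mem_openCell_iff {φ : ι → Dual ℝ E} {β : ι → ℝ} {κ s : ι → ℤ} {x t : E}
    (ht : ∀ i, φ i t = s i) : x + t ∈ openCell φ β (κ + s) ↔ x ∈ openCell φ β κ := by
  refine forall_congr' fun i => ?_
  rw [map_add, ht, Pi.add_apply, Int.cast_add]
  constructor <;> rintro ⟨h1, h2⟩ <;> constructor <;> linarith

lemma add_mem_closedCell_iff {φ : ι → Dual ℝ E} {β : ι → ℝ} {κ s : ι → ℤ} {x t : E}
    (ht : ∀ i, φ i t = s i) : x + t ∈ closedCell φ β (κ + s) ↔ x ∈ closedCell φ β κ := by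
  refine forall_congr' fun i => ?_
  rw [map_add, ht, Pi.add_apply, Int.cast_add]
  constructor <;> rintro ⟨h1, h2⟩ <;> constructor <;> linarith

lemma IsMinOn.add_closedCell {φ : ι → Dual ℝ E} {β : ι → ℝ} {κ s : ι → ℤ} {l : Dual ℝ E}
    {v t : E} (ht : ∀ i, φ i t = s i) (hmin : IsMinOn l (closedCell φ β κ) v) :
    IsMinOn l (closedCell φ β (κ + s)) (v + t) := fun y hy => by
  rw [← sub_add_cancel y t, add_mem_closedCell_iff ht] at hy
  have h : l v ≤ l (y - t) := hmin hy
  change l (v + t) ≤ l y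
  rw [map_sub] at h
  rw [map_add]
  linarith

lemma tendsto_add_mul_nhdsGT_zero (t s : ℝ) :
    Tendsto (fun ε : ℝ => t + ε * s) (𝓝[>] 0) (𝓝 t) := by
  have h : Continuous fun ε : ℝ => t + ε * s := by fun_prop
  have h0 := h.tendsto 0
  rw [zero_mul, add_zero] at h0
  exact h0.mono_left nhdsWithin_le_nhds

lemma eventually_add_mul_mem_Icc {l u t s : ℝ} (ht : l ≤ t ∧ t ≤ u)
    (hl : t = l → 0 ≤ s) (hu : t = u → s ≤ 0) :
    ∀ᶠ ε in 𝓝[>] (0 : ℝ), l ≤ t + ε * s ∧ t + ε * s ≤ u := by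
  have hc := tendsto_add_mul_nhdsGT_zero t s
  refine Eventually.and ?_ ?_
  · rcases ht.1.eq_or_lt with h | h
    · filter_upwards [self_mem_nhdsWithin] with ε (hε : 0 < ε)
      have := mul_nonneg hε.le (hl h.symm)
      linarith
    · exact (hc.eventually_const_lt h).mono fun _ => le_of_lt
  · rcases ht.2.eq_or_lt with h | h
    · filter_upwards [self_mem_nhdsWithin] with ε (hε : 0 < ε)
      have := mul_nonpos_of_nonneg_of_nonpos hε.le (hu h)
      linarith
    · exact (hc.eventually_lt_const h).mono fun _ => le_of_lt

lemma eventually_add_mul_mem_Ioo {l u t s : ℝ} (ht : l ≤ t ∧ t ≤ u)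
    (hl : t = l → 0 < s) (hu : t = u → s < 0) :
    ∀ᶠ ε in 𝓝[>] (0 : ℝ), l < t + ε * s ∧ t + ε * s < u := by
  have hc := tendsto_add_mul_nhdsGT_zero t s
  refine Eventually.and ?_ ?_
  · rcases ht.1.eq_or_lt with h | h
    · filter_upwards [self_mem_nhdsWithin] with ε (hε : 0 < ε)
      have := mul_pos hε (hl h.symm)
      linarith
    · exact hc.eventually_const_lt h
  · rcases ht.2.eq_or_lt with h | h
    · filter_upwards [self_mem_nhdsWithin] with ε (hε : 0 < ε)
      have := mul_neg_of_pos_of_neg hε (hu h)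
      linarith
    · exact hc.eventually_lt_const h

/-- Moving from a minimizer of `l` on a closed cell in a direction that does not
immediately leave the cell cannot decrease `l`. -/
lemma IsMinOn.nonneg_of_feasible [Finite ι] {φ : ι → Dual ℝ E} {β : ι → ℝ} {κ : ι → ℤ}
    {l : Dual ℝ E} {v w : E} (hv : v ∈ closedCell φ β κ) (hmin : IsMinOn l (closedCell φ β κ) v)
    (hlo : ∀ i, φ i v - β i = κ i → 0 ≤ φ i w)
    (hhi : ∀ i, φ i v - β i = κ i + 1 → φ i w ≤ 0) : 0 ≤ l w := by
  have h : ∀ᶠ ε in 𝓝[>] (0 : ℝ), ∀ i, (κ i : ℝ) ≤ φ i v - β i + ε * φ i w ∧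
      φ i v - β i + ε * φ i w ≤ κ i + 1 :=
    eventually_all.2 fun i => eventually_add_mul_mem_Icc (hv i) (hlo i) (hhi i)
  obtain ⟨ε, hε, hpos⟩ := (h.and self_mem_nhdsWithin).exists
  have hmem : v + ε • w ∈ closedCell φ β κ := fun i => by
    rw [map_add, map_smul, smul_eq_mul, add_sub_right_comm]
    exact hε i
  have := hmin hmem
  simp only [mem_ofPred_eq, map_add, map_smul, smul_eq_mul, le_add_iff_nonneg_right] at this
  exact nonneg_of_mul_nonneg_right this hpos

/-- Every finite family of functionals has a generic functional. -/
lemma exists_generic_dual [Finite ι] (φ : ι → Dual ℝ E) :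
    ∃ l : Dual ℝ E, ∀ T : Finset ι, T.card < finrank ℝ E →
      l ∉ Submodule.span ℝ (φ '' T) := by
  classical
  have := Fintype.ofFinite ι
  by_contra! h
  obtain ⟨⟨T, hT⟩, htop⟩ := Subspace.exists_eq_top_of_iUnion_eq_univ
    (p := fun T : {T : Finset ι // T.card < finrank ℝ E} => Submodule.span ℝ (φ '' T.1))
    (eq_univ_of_forall fun l => by
      obtain ⟨T, hT, hmem⟩ := h l
      exact mem_iUnion.2 ⟨⟨T, hT⟩, hmem⟩)
  have h1 := finrank_span_finset_le_card (R := ℝ) (T.image φ)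
  rw [Finset.coe_image] at h1
  have h2 : Set.finrank ℝ (φ '' (T : Set ι)) = finrank ℝ E := by
    rw [Set.finrank, htop, finrank_top, Subspace.dual_finrank_eq]
  have := Finset.card_image_le (s := T) (f := φ)
  lia

variable [FiniteDimensional ℝ E]

/-- `n` independent functionals on an `n`-dimensional space separate points. -/
lemma eq_zero_of_linearIndependent_card {φ : ι → Dual ℝ E} {S : Finset ι}
    (hS : LinearIndependent ℝ fun i : S => φ i) (hcard : S.card = finrank ℝ E) {x : E}
    (hx : ∀ i ∈ S, φ i x = 0) : x = 0 := by
  have hspan := hS.span_eq_top_of_card_eq_finrank' (by simp [hcard, Subspace.dual_finrank_eq])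
  rw [← forall_dual_apply_eq_zero_iff ℝ x]
  intro f
  have hf : f ∈ Submodule.span ℝ (range fun i : S => φ i) := hspan ▸ Submodule.mem_top
  induction hf using Submodule.span_induction with
  | mem f hf => obtain ⟨i, rfl⟩ := hf; exact hx i i.2
  | zero => rfl
  | add f g _ _ hf hg => simp [hf, hg]
  | smul c f _ hf => simp [hf]

lemma exists_forall_eq_of_linearIndependent_card {φ : ι → Dual ℝ E} {S : Finset ι}
    (hS : LinearIndependent ℝ fun i : S => φ i) (hcard : S.card = finrank ℝ E) (s : ι → ℝ) :
    ∃ w, ∀ i ∈ S, φ i w = s i := by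
  have hsurj : Function.Surjective (LinearMap.pi fun i : S => φ i) := by
    rw [← LinearMap.injective_iff_surjective_of_finrank_eq_finrank (by simp [hcard])]
    refine (injective_iff_map_eq_zero _).2 fun x hx => ?_
    exact eq_zero_of_linearIndependent_card hS hcard fun i hi => congrFun hx ⟨i, hi⟩
  obtain ⟨w, hw⟩ := hsurj fun i => s i
  exact ⟨w, fun i hi => congrFun hw ⟨i, hi⟩⟩

variable [Fintype ι]

/-- A minimizer of a generic functional on a closed cell is a vertex. -/
lemma card_incident_of_isMinOn {φ : ι → Dual ℝ E} {β : ι → ℝ} {κ : ι → ℤ} {l : Dual ℝ E}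
    (hl : ∀ T : Finset ι, T.card < finrank ℝ E → l ∉ Submodule.span ℝ (φ '' T)) {v : E}
    (hind : LinearIndependent ℝ fun i : incident φ β v => φ i)
    (hv : v ∈ closedCell φ β κ) (hmin : IsMinOn l (closedCell φ β κ) v) :
    (incident φ β v).card = finrank ℝ E := by
  refine le_antisymm ?_ (not_lt.1 fun hlt => hl _ hlt ?_)
  · simpa [Subspace.dual_finrank_eq] using hind.fintype_card_le_finrank
  have himage : φ '' (incident φ β v) = range fun i : incident φ β v => φ i := by
    ext; simp
  rw [himage]
  refine mem_span_of_iInf_ker_le_ker fun w hw => ?_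
  simp only [Submodule.mem_iInf, LinearMap.mem_ker, Subtype.forall] at hw ⊢
  have key : ∀ w : E, (∀ i ∈ incident φ β v, φ i w = 0) → 0 ≤ l w := fun w hw =>
    hmin.nonneg_of_feasible hv
      (fun i hi => (hw i ((mem_incident_iff hv).2 (.inl hi))).ge)
      (fun i hi => (hw i ((mem_incident_iff hv).2 (.inr hi))).le)
  refine le_antisymm ?_ (key w hw)
  have := key (-w) fun i hi => by rw [map_neg, hw i hi, neg_zero]
  rwa [map_neg, Left.nonneg_neg_iff] at this

/-- A generic functional has at most one minimizer on a closed cell. -/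
lemma eq_of_isMinOn_closedCell {φ : ι → Dual ℝ E} {β : ι → ℝ} {κ : ι → ℤ} {l : Dual ℝ E}
    (hind : ∀ x, LinearIndependent ℝ fun i : incident φ β x => φ i)
    (hl : ∀ T : Finset ι, T.card < finrank ℝ E → l ∉ Submodule.span ℝ (φ '' T)) {v v' : E}
    (hv : v ∈ closedCell φ β κ) (hmin : IsMinOn l (closedCell φ β κ) v)
    (hv' : v' ∈ closedCell φ β κ) (hmin' : IsMinOn l (closedCell φ β κ) v') : v = v' := by
  set x : E := (1 / 2 : ℝ) • (v + v') with hx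
  have hval : ∀ f : Dual ℝ E, f x = (f v + f v') / 2 := fun f => by
    rw [hx, map_smul, map_add, smul_eq_mul]; ring
  have hxmem : x ∈ closedCell φ β κ := fun i => by
    have h := hv i
    have h' := hv' i
    rw [hval]
    constructor <;> linarith
  have hxmin : IsMinOn l (closedCell φ β κ) x := fun y hy => by
    have h : l v ≤ l y := hmin hy
    have h' : l v' ≤ l y := hmin' hy
    change l x ≤ l y
    rw [hval]
    linarith
  have hcard := card_incident_of_isMinOn hl (hind x) hxmem hxmin
  refine sub_eq_zero.1 (eq_zero_of_linearIndependent_card (hind x) hcard fun i hi => ?_)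
  have h := hv i
  have h' := hv' i
  rw [map_sub]
  rcases (mem_incident_iff hxmem).1 hi with hi | hi <;> rw [hval] at hi <;> linarith

lemma apply_ne_zero_of_generic {φ : ι → Dual ℝ E} {l : Dual ℝ E}
    (hl : ∀ T : Finset ι, T.card < finrank ℝ E → l ∉ Submodule.span ℝ (φ '' T)) {S : Finset ι}
    (hS : LinearIndependent ℝ fun i : S => φ i) (hcard : S.card = finrank ℝ E) {w : E} {i : ι}
    (hi : i ∈ S) (hwi : φ i w ≠ 0) (hw : ∀ j ∈ S, j ≠ i → φ j w = 0) : l w ≠ 0 := by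
  classical
  intro h0
  refine hl (S.erase i) (by rw [← hcard]; exact Finset.card_erase_lt_of_mem hi) ?_
  have himage : φ '' (S.erase i) = range fun j : S.erase i => φ j := by
    ext; simp [and_comm]
  rw [himage]
  refine mem_span_of_iInf_ker_le_ker fun x hx => ?_
  simp only [Submodule.mem_iInf, LinearMap.mem_ker, Subtype.forall, Finset.mem_erase] at hx ⊢
  have : x = (φ i x / φ i w) • w := by
    refine sub_eq_zero.1 (eq_zero_of_linearIndependent_card hS hcard fun j hj => ?_)
    by_cases hji : j = i
    · subst hji; simp [hwi]
    · simp [hw j hj hji, hx j ⟨hji, hj⟩]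
  rw [this, map_smul, h0, smul_zero]

/-- Every vertex minimizes a generic functional on at most one closed cell. -/
lemma cell_eq_of_isMinOn {φ : ι → Dual ℝ E} {β : ι → ℝ} {κ κ' : ι → ℤ} {l : Dual ℝ E}
    (hl : ∀ T : Finset ι, T.card < finrank ℝ E → l ∉ Submodule.span ℝ (φ '' T)) {v : E}
    (hind : LinearIndependent ℝ fun i : incident φ β v => φ i)
    (hv : v ∈ closedCell φ β κ) (hmin : IsMinOn l (closedCell φ β κ) v)
    (hv' : v ∈ closedCell φ β κ') (hmin' : IsMinOn l (closedCell φ β κ') v) : κ = κ' := by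
  classical
  have hcard := card_incident_of_isMinOn hl hind hv hmin
  by_contra hne
  obtain ⟨i, hi⟩ := Function.ne_iff.1 hne
  wlog hlt : κ' i < κ i generalizing κ κ'
  · exact this hv' hmin' hv hmin (Ne.symm hne) (Ne.symm hi) (by lia)
  have h1 := hv i
  have h2 := hv' i
  have h3 : (κ' i + 1 : ℝ) ≤ κ i := by exact_mod_cast hlt
  have hlo : φ i v - β i = κ i := by linarith
  have hhi : φ i v - β i = κ' i + 1 := by linarith
  have hiS : i ∈ incident φ β v := (mem_incident_iff hv).2 (.inl hlo)
  obtain ⟨w, hw⟩ := exists_forall_eq_of_linearIndependent_card hind hcard (Pi.single i 1)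
  have hwi : φ i w = 1 := by simpa using hw i hiS
  have hwj : ∀ j ∈ incident φ β v, j ≠ i → φ j w = 0 := fun j hj hji => by
    simpa [hji] using hw j hj
  have hS : ∀ j ∈ incident φ β v, 0 ≤ φ j w := fun j hj => by
    by_cases hji : j = i
    · subst hji; simp [hwi]
    · exact (hwj j hj hji).ge
  refine apply_ne_zero_of_generic hl hind hcard hiS (by simp [hwi]) hwj (le_antisymm ?_ ?_)
  · have := hmin'.nonneg_of_feasible hv' (w := -w) (fun j hj => ?_) (fun j hj => ?_)
    · rwa [map_neg, Left.nonneg_neg_iff] at this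
    · by_cases hji : j = i
      · subst hji; linarith
      · rw [map_neg, hwj j ((mem_incident_iff hv').2 (.inl hj)) hji, neg_zero]
    · rw [map_neg, neg_nonpos]
      exact hS j ((mem_incident_iff hv').2 (.inr hj))
  · refine hmin.nonneg_of_feasible hv (fun j hj => ?_) (fun j hj => ?_)
    · exact hS j ((mem_incident_iff hv).2 (.inl hj))
    · by_cases hji : j = i
      · subst hji; linarith
      · exact (hwj j ((mem_incident_iff hv).2 (.inr hj)) hji).le

/-- Every vertex minimizes a generic functional on some closed cell with nonempty interior. -/
lemma exists_cell_isMinOn {φ : ι → Dual ℝ E} {β : ι → ℝ} {l : Dual ℝ E}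
    (hl : ∀ T : Finset ι, T.card < finrank ℝ E → l ∉ Submodule.span ℝ (φ '' T)) {v : E}
    (hind : LinearIndependent ℝ fun i : incident φ β v => φ i)
    (hcard : (incident φ β v).card = finrank ℝ E) :
    ∃ κ, (openCell φ β κ).Nonempty ∧ v ∈ closedCell φ β κ ∧ IsMinOn l (closedCell φ β κ) v := by
  classical
  have hspan := hind.span_eq_top_of_card_eq_finrank' (by simp [hcard, Subspace.dual_finrank_eq])
  have hmem : l ∈ Submodule.span ℝ (range fun i : incident φ β v => φ i) := hspan ▸ Submodule.mem_top
  obtain ⟨c, hc⟩ := (Submodule.mem_span_range_iff_exists_fun ℝ).1 hmem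
  set lam : ι → ℝ := fun i => if h : i ∈ incident φ β v then c ⟨i, h⟩ else 0 with hlam
  have hsum : ∀ x, l x = ∑ i ∈ incident φ β v, lam i * φ i x := fun x => by
    rw [← hc, LinearMap.sum_apply, ← Finset.sum_coe_sort _ fun i => lam i * φ i x]
    exact Finset.sum_congr rfl fun i _ => by simp [hlam]
  have hne : ∀ i ∈ incident φ β v, lam i ≠ 0 := fun i hi => by
    obtain ⟨w, hw⟩ := exists_forall_eq_of_linearIndependent_card hind hcard (Pi.single i 1)
    have := apply_ne_zero_of_generic hl hind hcard hi (w := w) (by simp [hw i hi])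
      (fun j hj hji => by simp [hw j hj, hji])
    rw [hsum, Finset.sum_congr rfl fun j hj => by rw [hw j hj]] at this
    simpa [Pi.single_apply, hi] using this
  set κ : ι → ℤ := fun i =>
    if i ∈ incident φ β v ∧ lam i < 0 then ⌊φ i v - β i⌋ - 1 else ⌊φ i v - β i⌋ with hκ
  have hfloor : ∀ i ∈ incident φ β v, (⌊φ i v - β i⌋ : ℝ) = φ i v - β i := fun i hi => by
    obtain ⟨k, hk⟩ := mem_incident.1 hi
    rw [hk, Int.floor_intCast]
  have hneg : ∀ i ∈ incident φ β v, lam i < 0 → φ i v - β i = κ i + 1 := fun i hi h => by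
    simp [hκ, hi, h, hfloor i hi]
  have hpos : ∀ i ∈ incident φ β v, 0 < lam i → φ i v - β i = κ i := fun i hi h => by
    simp [hκ, h.le, hfloor i hi]
  have hv : v ∈ closedCell φ β κ := fun i => by
    by_cases hi : i ∈ incident φ β v
    · rcases (hne i hi).lt_or_gt with h | h
      · rw [hneg i hi h]; constructor <;> linarith
      · rw [hpos i hi h]; constructor <;> linarith
    · simp only [hκ, hi, false_and, if_false]
      exact ⟨Int.floor_le _, (Int.lt_floor_add_one _).le⟩
  refine ⟨κ, ?_, hv, fun x hx => ?_⟩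
  · obtain ⟨w, hw⟩ := exists_forall_eq_of_linearIndependent_card hind hcard lam
    have h : ∀ᶠ ε in 𝓝[>] (0 : ℝ), ∀ i, (κ i : ℝ) < φ i v - β i + ε * φ i w ∧
        φ i v - β i + ε * φ i w < κ i + 1 := by
      refine eventually_all.2 fun i => eventually_add_mul_mem_Ioo (hv i) (fun h => ?_) fun h => ?_
      · have hi := (mem_incident_iff hv).2 (.inl h)
        rw [hw i hi]
        refine (hne i hi).lt_or_gt.resolve_left fun h' => ?_
        linarith [hneg i hi h']
      · have hi := (mem_incident_iff hv).2 (.inr h)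
        rw [hw i hi]
        refine (hne i hi).lt_or_gt.resolve_right fun h' => ?_
        linarith [hpos i hi h']
    obtain ⟨ε, hε⟩ := h.exists
    refine ⟨v + ε • w, fun i => ?_⟩
    rw [map_add, map_smul, smul_eq_mul, add_sub_right_comm]
    exact hε i
  · change l v ≤ l x
    rw [hsum, hsum]
    refine Finset.sum_le_sum fun i hi => ?_
    have hxi := hx i
    rcases (hne i hi).lt_or_gt with h | h
    · exact mul_le_mul_of_nonpos_left (by linarith [hneg i hi h]) h.le
    · exact mul_le_mul_of_nonneg_left (by linarith [hpos i hi h]) h.le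

end Cells

section Torus

open Module

/-- The covering projection `ℝⁿ → ℝⁿ/ℤⁿ`. -/
def toTorus {n : ℕ} (x : Fin n → ℝ) : Torus n := fun i => (x i : AddCircle (1 : ℝ))

lemma toTorus_surjective {n : ℕ} : Function.Surjective (toTorus (n := n)) := fun p => by
  choose x hx using fun i => QuotientAddGroup.mk_surjective (p i)
  exact ⟨x, funext hx⟩

lemma continuous_toTorus {n : ℕ} : Continuous (toTorus (n := n)) :=
  continuous_pi fun i => continuous_quotient_mk'.comp (continuous_apply i)

lemma isOpenMap_toTorus {n : ℕ} : IsOpenMap (toTorus (n := n)) :=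
  IsOpenMap.piMap (fun _ => QuotientAddGroup.isOpenMap_coe)
    (Filter.Eventually.of_forall fun _ => QuotientAddGroup.mk_surjective)

lemma coe_addCircle_eq_coe_iff {x y : ℝ} :
    (x : AddCircle (1 : ℝ)) = y ↔ ∃ k : ℤ, x - y = k := by
  rw [← sub_eq_zero, ← AddCircle.coe_sub, AddCircle.coe_eq_zero_iff]
  simp [eq_comm]

lemma toTorus_eq_iff {n : ℕ} {x y : Fin n → ℝ} :
    toTorus x = toTorus y ↔ ∃ z : Fin n → ℤ, x = y + fun i => (z i : ℝ) := by
  simp only [funext_iff, toTorus, coe_addCircle_eq_coe_iff, Pi.add_apply, sub_eq_iff_eq_add']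
  exact Classical.skolem

lemma theta_toTorus {n : ℕ} (a : Fin n → ℤ) (x : Fin n → ℝ) :
    theta a (toTorus x) = ((∑ i, a i * x i : ℝ) : AddCircle (1 : ℝ)) := by
  rw [← QuotientAddGroup.mk'_apply, map_sum]
  refine Finset.sum_congr rfl fun i _ => ?_
  rw [← zsmul_eq_mul, map_zsmul]
  rfl

/-- A system of `n` independent integer linear equations on the `n`-torus has exactly
`|det|` solutions. -/
lemma card_theta_eq {n : ℕ} (M : Matrix (Fin n) (Fin n) ℤ) (hM : M.det ≠ 0)
    (c : Fin n → AddCircle (1 : ℝ)) :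
    Nat.card {p : Torus n // ∀ k, theta (M k) p = c k} = M.det.natAbs := by
  obtain ⟨β, rfl⟩ := toTorus_surjective c
  set A : Matrix (Fin n) (Fin n) ℝ := M.map (Int.castRingHom ℝ) with hA
  have hdet : IsUnit A.det := by
    rw [hA, ← RingHom.mapMatrix_apply, ← RingHom.map_det]
    simpa using hM
  have htheta : ∀ x, (fun k => theta (M k) (toTorus x)) = toTorus (A.mulVec x) := fun x => by
    funext k
    rw [theta_toTorus]
    rfl
  have hcast : ∀ z : Fin n → ℤ, A.mulVec (fun i => (z i : ℝ)) = fun i => (M.mulVec z i : ℝ) :=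
    fun z => by
      funext i
      simp [hA, Matrix.mulVec, dotProduct]
  have hinv : ∀ y, A.mulVec (A⁻¹.mulVec y) = y := fun y => by
    rw [Matrix.mulVec_mulVec, Matrix.mul_nonsing_inv _ hdet, Matrix.one_mulVec]
  have hinv' : ∀ y, A⁻¹.mulVec (A.mulVec y) = y := fun y => by
    rw [Matrix.mulVec_mulVec, Matrix.nonsing_inv_mul _ hdet, Matrix.one_mulVec]
  let N : Submodule ℤ (Fin n → ℤ) := LinearMap.range (Matrix.toLin' M)
  have hinj : Function.Injective (Matrix.toLin' M) := by
    rw [Matrix.toLin'_apply']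
    exact Matrix.mulVec_injective_of_det_ne_zero hM
  have hN : M.det.natAbs = Nat.card ((Fin n → ℤ) ⧸ N) := by
    rw [← N.natAbs_det_equiv (LinearEquiv.ofInjective _ hinj), ← LinearMap.det_toLin']
    rfl
  let g : (Fin n → ℤ) → Torus n := fun k => toTorus (A⁻¹.mulVec (β + fun i => (k i : ℝ)))
  have hg : ∀ k k', g k = g k' ↔ k - k' ∈ N := fun k k' => by
    simp only [g, toTorus_eq_iff, N, LinearMap.mem_range, Matrix.toLin'_apply]
    refine exists_congr fun z => ?_
    have hz : (fun i => (z i : ℝ)) = A⁻¹.mulVec (fun i => (M.mulVec z i : ℝ)) := by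
      rw [← hcast, hinv']
    rw [hz, ← Matrix.mulVec_add,
      (Function.LeftInverse.injective hinv).eq_iff, funext_iff, funext_iff]
    refine forall_congr' fun i => ?_
    simp only [Pi.add_apply, Pi.sub_apply, add_assoc, add_right_inj]
    norm_cast
    lia
  have hgsol : ∀ k i, theta (M i) (g k) = toTorus β i := fun k => by
    rw [← funext_iff, htheta, hinv, toTorus_eq_iff]
    exact ⟨k, rfl⟩
  rw [hN]
  symm
  refine Nat.card_eq_of_bijective
    (fun q : (Fin n → ℤ) ⧸ N => (⟨g q.out, hgsol _⟩ : {p // ∀ k, theta (M k) p = toTorus β k}))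
    ⟨fun q q' h => ?_, fun p => ?_⟩
  · rw [← q.out_eq, ← q'.out_eq]
    exact (Submodule.Quotient.eq N).2 ((hg _ _).1 (congrArg Subtype.val h))
  · obtain ⟨p, hp⟩ := p
    obtain ⟨y, rfl⟩ := toTorus_surjective p
    rw [← funext_iff, htheta, toTorus_eq_iff] at hp
    obtain ⟨k, hk⟩ := hp
    refine ⟨Submodule.Quotient.mk k, Subtype.ext ?_⟩
    have : toTorus y = g k := by rw [← hinv' y, hk]
    refine Eq.trans ?_ this.symm
    exact (hg _ _).2 ((Submodule.Quotient.eq N).1 (Quotient.out_eq _))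

/-- The linear functional on `ℝⁿ` with integer coefficient vector `a`. -/
noncomputable def functional {n : ℕ} (a : Fin n → ℤ) : Dual ℝ (Fin n → ℝ) :=
  dotProductEquiv ℝ (Fin n) fun j => (a j : ℝ)

lemma functional_apply {n : ℕ} (a : Fin n → ℤ) (x : Fin n → ℝ) :
    functional a x = ∑ j, a j * x j := rfl

lemma functional_intCast {n : ℕ} (a z : Fin n → ℤ) :
    functional a (fun j => (z j : ℝ)) = ((a ⬝ᵥ z : ℤ) : ℝ) := by
  simp [functional_apply, dotProduct]

lemma toTorus_mem_Hyp_iff {n : ℕ} {a : Fin n → ℤ} {β : ℝ} {x : Fin n → ℝ} :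
    toTorus x ∈ Hyp a (β : AddCircle (1 : ℝ)) ↔ ∃ k : ℤ, functional a x - β = k := by
  rw [Hyp, mem_ofPred_eq, theta_toTorus, coe_addCircle_eq_coe_iff, functional_apply]

lemma linearIndependent_intCast_iff {ι κ K : Type*} [Finite κ] [Field K] [CharZero K]
    {v : ι → κ → ℤ} :
    LinearIndependent K (fun i j => (v i j : K)) ↔ LinearIndependent ℤ v :=
  linearIndependent_algebraMap_comp_iff (R := ℤ) (S := K)

lemma det_ne_zero_of_linearIndependent_intCast {n : ℕ} {M : Matrix (Fin n) (Fin n) ℤ}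
    (h : LinearIndependent ℚ fun k j => (M k j : ℚ)) : M.det ≠ 0 := by
  have hu := Matrix.linearIndependent_rows_iff_isUnit (A := M.map (Int.castRingHom ℚ)).1 h
  rw [Matrix.isUnit_iff_isUnit_det, ← RingHom.mapMatrix_apply, ← RingHom.map_det] at hu
  simpa using hu

lemma linearIndependent_functional_iff {ι : Type*} {n : ℕ} {v : ι → Fin n → ℤ} :
    LinearIndependent ℝ (fun i => functional (v i)) ↔
      LinearIndependent ℚ fun i j => (v i j : ℚ) := by
  rw [linearIndependent_intCast_iff, ← linearIndependent_intCast_iff (K := ℝ)]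
  exact (dotProductEquiv ℝ (Fin n)).toLinearMap.linearIndependent_iff (LinearEquiv.ker _)

lemma connectedComponentIn_eq_of_isOpen {X : Type*} [TopologicalSpace X] {U C : Set X} {x : X}
    (hxC : x ∈ C) (hCU : C ⊆ U) (hconn : IsPreconnected C) (hC : IsOpen C)
    (hUC : IsOpen (U \ C)) : connectedComponentIn U x = C := by
  refine Subset.antisymm ?_ (hconn.subset_connectedComponentIn hxC hCU)
  refine isPreconnected_connectedComponentIn.subset_left_of_subset_union hC hUC
    disjoint_sdiff_right ?_ ⟨x, mem_connectedComponentIn (hCU hxC), hxC⟩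
  rw [union_sdiff_cancel hCU]
  exact connectedComponentIn_subset U x

variable {n : ℕ} {ι : Type*}

lemma add_intCast_mem_openCell_iff {a : ι → Fin n → ℤ} {β : ι → ℝ} {κ : ι → ℤ}
    {x : Fin n → ℝ} (z : Fin n → ℤ) :
    x + (fun j => (z j : ℝ)) ∈ openCell (fun i => functional (a i)) β (κ + fun i => a i ⬝ᵥ z) ↔
      x ∈ openCell (fun i => functional (a i)) β κ :=
  add_mem_openCell_iff fun i => functional_intCast (a i) z

/-- If the images of two open cells meet, the cells are lattice translates of each other. -/
lemma exists_cell_eq_add {a : ι → Fin n → ℤ} {β : ι → ℝ} {κ κ' : ι → ℤ} {x x' : Fin n → ℝ}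
    (hx : x ∈ openCell (fun i => functional (a i)) β κ)
    (hx' : x' ∈ openCell (fun i => functional (a i)) β κ') (h : toTorus x = toTorus x') :
    ∃ z : Fin n → ℤ, κ = κ' + fun i => a i ⬝ᵥ z := by
  obtain ⟨z, rfl⟩ := toTorus_eq_iff.1 h
  exact ⟨z, cell_eq_of_mem_openCell hx ((add_intCast_mem_openCell_iff z).2 hx')⟩

lemma image_openCell_add (a : ι → Fin n → ℤ) (β : ι → ℝ) (κ : ι → ℤ) (z : Fin n → ℤ) :
    toTorus '' openCell (fun i => functional (a i)) β (κ + fun i => a i ⬝ᵥ z) =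
      toTorus '' openCell (fun i => functional (a i)) β κ := by
  have hz : ∀ x : Fin n → ℝ, toTorus (x + fun j => (z j : ℝ)) = toTorus x := fun x =>
    toTorus_eq_iff.2 ⟨z, rfl⟩
  ext p
  constructor
  · rintro ⟨x, hx, rfl⟩
    rw [← sub_add_cancel x fun j => (z j : ℝ)] at hx ⊢
    exact ⟨_, (add_intCast_mem_openCell_iff z).1 hx, (hz _).symm⟩
  · rintro ⟨x, hx, rfl⟩
    exact ⟨_, (add_intCast_mem_openCell_iff z).2 hx, hz x⟩

lemma toTorus_mem_compl_iff {a : ι → Fin n → ℤ} {β : ι → ℝ} {x : Fin n → ℝ} :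
    toTorus x ∈ univ \ ⋃ i, Hyp (a i) (β i : AddCircle (1 : ℝ)) ↔
      ∃ κ, x ∈ openCell (fun i => functional (a i)) β κ := by
  simp only [mem_sdiff, mem_univ, true_and, mem_iUnion, toTorus_mem_Hyp_iff, not_exists]
  constructor
  · exact fun h => ⟨fun i => ⌊functional (a i) x - β i⌋, fun i =>
      ⟨(Int.floor_le _).lt_of_ne (Ne.symm (h i _)), Int.lt_floor_add_one _⟩⟩
  · rintro ⟨κ, hx⟩ i k hk
    have := hx i
    rw [hk] at this
    norm_cast at this
    lia

/-- The regions of a toric arrangement are the images of the nonempty open cells. -/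
lemma comps_compl_eq [Finite ι] (a : ι → Fin n → ℤ) (β : ι → ℝ) :
    comps (univ \ ⋃ i, Hyp (a i) (β i : AddCircle (1 : ℝ))) =
      {C | ∃ κ, (openCell (fun i => functional (a i)) β κ).Nonempty ∧
        C = toTorus '' openCell (fun i => functional (a i)) β κ} := by
  set U := univ \ ⋃ i, Hyp (a i) (β i : AddCircle (1 : ℝ)) with hU
  have hopen : ∀ κ, IsOpen (toTorus '' openCell (fun i => functional (a i)) β κ) := fun κ =>
    isOpenMap_toTorus _ (isOpen_openCell _ _ _)
  have hsub : ∀ κ, toTorus '' openCell (fun i => functional (a i)) β κ ⊆ U := by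
    rintro κ _ ⟨x, hx, rfl⟩
    exact toTorus_mem_compl_iff.2 ⟨κ, hx⟩
  have key : ∀ κ x, x ∈ openCell (fun i => functional (a i)) β κ →
      connectedComponentIn U (toTorus x) =
        toTorus '' openCell (fun i => functional (a i)) β κ := fun κ x hx => by
    refine connectedComponentIn_eq_of_isOpen (mem_image_of_mem _ hx) (hsub κ)
      ((convex_openCell _ _ _).isPreconnected.image _ continuous_toTorus.continuousOn)
      (hopen κ) (isOpen_iff_forall_mem_open.2 ?_)
    rintro p ⟨hpU, hp⟩
    obtain ⟨y, rfl⟩ := toTorus_surjective p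
    obtain ⟨κ', hy⟩ := toTorus_mem_compl_iff.1 hpU
    refine ⟨_, subset_sdiff.2 ⟨hsub κ', disjoint_left.2 ?_⟩, hopen κ', mem_image_of_mem _ hy⟩
    rintro _ ⟨x₁, hx₁, rfl⟩ ⟨x₂, hx₂, h⟩
    obtain ⟨z, rfl⟩ := exists_cell_eq_add hx₁ hx₂ h.symm
    exact hp (image_openCell_add a β κ z ▸ mem_image_of_mem toTorus hy)
  ext C
  constructor
  · rintro ⟨p, hp, rfl⟩
    obtain ⟨x, rfl⟩ := toTorus_surjective p
    obtain ⟨κ, hx⟩ := toTorus_mem_compl_iff.1 hp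
    exact ⟨κ, ⟨x, hx⟩, key κ x hx⟩
  · rintro ⟨κ, ⟨x, hx⟩, rfl⟩
    exact ⟨toTorus x, hsub κ (mem_image_of_mem _ hx), (key κ x hx).symm⟩

/-- Sending each region to the lowest vertex of a lift, for a generic height function, gives a
bijection between regions and vertices. -/
lemma card_comps_compl_eq [Fintype ι] (a : ι → Fin n → ℤ) (β : ι → ℝ)
    (hsep : ∀ x, (∀ i, functional (a i) x = 0) → x = 0)
    (hind : ∀ x, LinearIndependent ℝ
      fun i : incident (fun i => functional (a i)) β x => functional (a i)) :
    Nat.card (comps (univ \ ⋃ i, Hyp (a i) (β i : AddCircle (1 : ℝ)))) =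
      Nat.card {p : Torus n // ∃ v, toTorus v = p ∧
        (incident (fun i => functional (a i)) β v).card = n} := by
  rw [comps_compl_eq]
  set φ : ι → Dual ℝ (Fin n → ℝ) := fun i => functional (a i) with hφ
  obtain ⟨l, hl⟩ := exists_generic_dual φ
  have hlow : ∀ p : {p : Torus n // ∃ v, toTorus v = p ∧ (incident φ β v).card = n},
      ∃ v κ, toTorus v = p ∧ (openCell φ β κ).Nonempty ∧ v ∈ closedCell φ β κ ∧
        IsMinOn l (closedCell φ β κ) v := by
    rintro ⟨p, v, hvp, hcard⟩
    obtain ⟨κ, hκ⟩ := exists_cell_isMinOn hl (hind v) (by simpa using hcard)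
    exact ⟨v, κ, hvp, hκ⟩
  choose v κ hv hne hmem hmin using hlow
  have ht : ∀ (z : Fin n → ℤ) i, φ i (fun j => (z j : ℝ)) = ((a i ⬝ᵥ z : ℤ) : ℝ) := fun z i =>
    functional_intCast (a i) z
  symm
  refine Nat.card_eq_of_bijective (fun p => ⟨toTorus '' openCell φ β (κ p), κ p, hne p, rfl⟩)
    ⟨fun p p' h => ?_, ?_⟩
  · obtain ⟨x, hx⟩ := hne p
    obtain ⟨x', hx', hxx'⟩ : toTorus x ∈ toTorus '' openCell φ β (κ p') :=
      (Subtype.ext_iff.1 h).subset (mem_image_of_mem toTorus hx)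
    obtain ⟨z, hz⟩ := exists_cell_eq_add hx' hx hxx'
    have hm := hmem p'
    have hm' := hmin p'
    rw [hz] at hm hm'
    have := eq_of_isMinOn_closedCell hind hl hm hm' ((add_mem_closedCell_iff (ht z)).2 (hmem p))
      ((hmin p).add_closedCell (ht z))
    rw [Subtype.ext_iff, ← hv p, ← hv p', this, eq_comm]
    exact toTorus_eq_iff.2 ⟨z, rfl⟩
  · rintro ⟨_, κ₀, ⟨x, hx⟩, rfl⟩
    obtain ⟨v₀, hv₀, hmin₀⟩ := (isCompact_closedCell hsep β κ₀).exists_isMinOn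
      ⟨x, openCell_subset_closedCell _ _ _ hx⟩ l.continuous_of_finiteDimensional.continuousOn
    have hcard := card_incident_of_isMinOn hl (hind v₀) hv₀ hmin₀
    refine ⟨⟨toTorus v₀, v₀, rfl, by simpa using hcard⟩, Subtype.ext ?_⟩
    set p : {p : Torus n // ∃ v, toTorus v = p ∧ (incident φ β v).card = n} :=
      ⟨toTorus v₀, v₀, rfl, by simpa using hcard⟩
    obtain ⟨z, hz⟩ := toTorus_eq_iff.1 (hv p)
    have hm := hmem p
    have hm' := hmin p
    have hi := hind (v p)
    rw [hz] at hm hm' hi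
    have := cell_eq_of_isMinOn hl hi hm hm' ((add_mem_closedCell_iff (ht z)).2 hv₀)
      (hmin₀.add_closedCell (ht z))
    change toTorus '' openCell φ β (κ p) = _
    rw [this]
    exact image_openCell_add a β κ₀ z

lemma GenPos.linearIndependent_incident [Fintype ι] {a : ι → Fin n → ℤ} {β : ι → ℝ}
    (h : GenPos a fun i => (β i : AddCircle (1 : ℝ))) (x : Fin n → ℝ) :
    LinearIndependent ℝ
      fun i : incident (fun i => functional (a i)) β x => functional (a i) := by
  refine linearIndependent_functional_iff.2 (h _ ⟨toTorus x, ?_⟩)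
  simp only [mem_iInter, toTorus_mem_Hyp_iff]
  exact fun i hi => mem_incident.1 hi

lemma GenPos.card_le [Fintype ι] {a : ι → Fin n → ℤ} {b : ι → AddCircle (1 : ℝ)}
    (h : GenPos a b) {S : Finset ι} {p : Torus n} (hp : ∀ i ∈ S, p ∈ Hyp (a i) (b i)) :
    S.card ≤ n := by
  simpa using (h S ⟨p, by simpa using hp⟩).fintype_card_le_finrank

/-- In general position, a point lies on all hyperplanes of at most one `n`-element subset. -/
lemma GenPos.eq_of_card_eq [Fintype ι] {a : ι → Fin n → ℤ} {b : ι → AddCircle (1 : ℝ)}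
    (h : GenPos a b) {S S' : Finset ι} {p : Torus n} (hS : S.card = n) (hS' : S'.card = n)
    (hp : ∀ i ∈ S, p ∈ Hyp (a i) (b i)) (hp' : ∀ i ∈ S', p ∈ Hyp (a i) (b i)) : S = S' := by
  classical
  have hle : (S ∪ S').card ≤ n := h.card_le fun i hi => (Finset.mem_union.1 hi).elim (hp i) (hp' i)
  rw [Finset.eq_of_subset_of_card_le (s := S) Finset.subset_union_left (hle.trans hS.ge),
    ← Finset.eq_of_subset_of_card_le (s := S') Finset.subset_union_right (hle.trans hS'.ge)]

lemma GenPos.exists_vertex_iff [Fintype ι] {a : ι → Fin n → ℤ} {β : ι → ℝ}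
    (h : GenPos a fun i => (β i : AddCircle (1 : ℝ))) (p : Torus n) :
    (∃ v, toTorus v = p ∧ (incident (fun i => functional (a i)) β v).card = n) ↔
      ∃ S : Finset ι, S.card = n ∧ ∀ i ∈ S, p ∈ Hyp (a i) (β i : AddCircle (1 : ℝ)) := by
  constructor
  · rintro ⟨v, rfl, hv⟩
    exact ⟨_, hv, fun i hi => toTorus_mem_Hyp_iff.2 (mem_incident.1 hi)⟩
  · rintro ⟨S, hS, hp⟩
    obtain ⟨v, rfl⟩ := toTorus_surjective p
    refine ⟨v, rfl, le_antisymm (h.card_le (p := toTorus v) fun i hi =>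
      toTorus_mem_Hyp_iff.2 (mem_incident.1 hi)) ?_⟩
    refine hS.ge.trans ?_
    exact Finset.card_le_card fun i hi => mem_incident.2 (toTorus_mem_Hyp_iff.1 (hp i hi))

/-- The `n`-fold intersection indexed by `S` consists of `|det|` points. -/
lemma GenPos.card_inter {m : ℕ} {a : Fin m → Fin n → ℤ} {b : Fin m → AddCircle (1 : ℝ)}
    (h : GenPos a b) {S : Finset (Fin m)} (hS : S.card = n) :
    Finite {p : Torus n // ∀ i ∈ S, p ∈ Hyp (a i) (b i)} ∧
      Nat.card {p : Torus n // ∀ i ∈ S, p ∈ Hyp (a i) (b i)} =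
        (Matrix.of fun k q => a (S.orderEmbOfFin hS k) q).det.natAbs := by
  set M : Matrix (Fin n) (Fin n) ℤ := Matrix.of fun k q => a (S.orderEmbOfFin hS k) q with hM
  by_cases hdet : M.det = 0
  · have : IsEmpty {p : Torus n // ∀ i ∈ S, p ∈ Hyp (a i) (b i)} := by
      refine ⟨fun ⟨p, hp⟩ => ?_⟩
      have hli := (h S ⟨p, by simpa using hp⟩).comp
        (fun k => ⟨S.orderEmbOfFin hS k, S.orderEmbOfFin_mem hS k⟩)
        fun k k' hk => (S.orderEmbOfFin hS).injective (congrArg Subtype.val hk)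
      exact det_ne_zero_of_linearIndependent_intCast (M := M) hli hdet
    exact ⟨inferInstance, by simp [hdet]⟩
  · have hcard : Nat.card {p : Torus n // ∀ i ∈ S, p ∈ Hyp (a i) (b i)} = M.det.natAbs := by
      rw [← card_theta_eq M hdet fun k => b (S.orderEmbOfFin hS k)]
      refine Nat.card_congr (Equiv.subtypeEquivRight fun p => ?_)
      constructor
      · exact fun hp k => hp _ (S.orderEmbOfFin_mem hS k)
      · intro hp i hi
        rw [← Finset.mem_coe, ← S.range_orderEmbOfFin hS] at hi
        obtain ⟨k, rfl⟩ := hi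
        exact hp k
    exact ⟨Nat.finite_of_card_ne_zero (by simpa [hcard] using hdet), hcard⟩

lemma GenPos.card_vertices {m : ℕ} {a : Fin m → Fin n → ℤ} {b : Fin m → AddCircle (1 : ℝ)}
    (h : GenPos a b) :
    Nat.card {p : Torus n // ∃ S : Finset (Fin m), S.card = n ∧ ∀ i ∈ S, p ∈ Hyp (a i) (b i)} =
      ∑ S ∈ (Finset.powersetCard n (Finset.univ : Finset (Fin m))).attach,
        (Matrix.of fun p q : Fin n =>
          a (S.1.orderEmbOfFin (Finset.mem_powersetCard.mp S.2).2 p) q).det.natAbs := by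
  have hcard := fun S : Finset.powersetCard n (Finset.univ : Finset (Fin m)) =>
    h.card_inter (Finset.mem_powersetCard.1 S.2).2
  have := fun S => (hcard S).1
  rw [← Finset.sum_congr rfl fun S _ => (hcard S).2, ← Finset.univ_eq_attach, ← Nat.card_sigma]
  symm
  refine Nat.card_eq_of_bijective (fun x => ⟨x.2.1, x.1.1, (Finset.mem_powersetCard.1 x.1.2).2,
    x.2.2⟩) ⟨?_, ?_⟩
  · rintro ⟨⟨S, hS⟩, p, hp⟩ ⟨⟨S', hS'⟩, p', hp'⟩ heq
    obtain rfl : p = p' := congrArg Subtype.val heq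
    obtain rfl := h.eq_of_card_eq (Finset.mem_powersetCard.1 hS).2 (Finset.mem_powersetCard.1 hS').2
      hp hp'
    rfl
  · rintro ⟨p, S, hS, hp⟩
    exact ⟨⟨⟨S, Finset.mem_powersetCard.2 ⟨Finset.subset_univ _, hS⟩⟩, p, hp⟩, rfl⟩

lemma Spanning.eq_zero [Fintype ι] {a : ι → Fin n → ℤ} (h : Spanning a) {x : Fin n → ℝ}
    (hx : ∀ i, functional (a i) x = 0) : x = 0 := by
  obtain ⟨S, hS, hli⟩ := h
  exact eq_zero_of_linearIndependent_card (φ := fun i => functional (a i))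
    (linearIndependent_functional_iff.2 hli) (by simpa using hS) fun i _ => hx i

end Torus

lemma SigIn_top {X ι : Type*} [TopologicalSpace X] [Fintype ι] {W : Set X} {d : ℕ}
    {K : ι → Set X} (hd : d ≠ 0) : SigIn W d K d = comps (W \ ⋃ i, K i) := by
  rw [SigIn, Nat.strongRecOn_eq, if_neg hd, if_pos rfl]

lemma SigIn_zero {X ι : Type*} [TopologicalSpace X] [Fintype ι] (d : ℕ) {W : Set X}
    {K : ι → Set X} :
    SigIn W d K 0 = comps (⋃ S ∈ {S : Finset ι | S.card = d}, ⋂ i ∈ S, K i) := by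
  rw [SigIn, Nat.strongRecOn_eq, if_pos rfl]

/-- For a spanning toric hyperplane arrangement in general position of `m ≥ n`
hyperplanes on `Tⁿ`, the number of `n`-flats (regions) is the sum, over all `n`-element
subsets `S` of the hyperplanes, of the absolute values of the determinants of the
matrices formed by the corresponding normal vectors. -/
theorem card_regions_eq_sum_det {n m : ℕ}
    (a : Fin m → Fin n → ℤ) (b : Fin m → AddCircle (1 : ℝ))
    (ha : ∀ i, a i ≠ 0) (hm : n ≤ m) (hspan : Spanning a) (hgp : GenPos a b) :
    Nat.card ↥(SigIn Set.univ n (fun i => Hyp (a i) (b i)) n) =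
      ∑ S ∈ (Finset.powersetCard n (Finset.univ : Finset (Fin m))).attach,
        (Matrix.of fun p q : Fin n =>
          a (S.1.orderEmbOfFin (Finset.mem_powersetCard.mp S.2).2 p) q).det.natAbs := by
  choose β hβ using fun i => QuotientAddGroup.mk_surjective (b i)
  obtain rfl : (fun i => (β i : AddCircle (1 : ℝ))) = b := funext hβ
  have hregions : SigIn univ n (fun i => Hyp (a i) (β i : AddCircle (1 : ℝ))) n =
      comps (univ \ ⋃ i, Hyp (a i) (β i : AddCircle (1 : ℝ))) := by
    rcases eq_or_ne n 0 with rfl | hn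
    · have : IsEmpty (Fin m) := ⟨fun i => ha i (Subsingleton.elim _ _)⟩
      rw [SigIn_zero]
      congr 1
      ext p
      simp
    · exact SigIn_top hn
  rw [hregions, card_comps_compl_eq a β (fun _ => hspan.eq_zero) hgp.linearIndependent_incident,
    ← hgp.card_vertices]
  exact Nat.card_congr (Equiv.subtypeEquivRight hgp.exists_vertex_iff)
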